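/- Let M be a finitely generated flat module over a commutative ring R. Then M is projective if and only if the rank function Spec R \to \mathbb{N}, sending a prime p to the rank of the free R_p-module M_p, is locally constant. -/

import Mathlib

theorem finitePresentation_of_rankAtStalk_const
    (R M : Type*) [CommRing R] [AddCommGroup M] [Module R M]
    [Module.Finite R M] [Module.Flat R M] (n : ℕ)
    (h : ∀ p : PrimeSpectrum R, Module.rankAtStalk M p = n) :
    Module.FinitePresentation R M := by
  let s : Set R := {a | Module.Free (Localization.Away a) (LocalizedModule.Away a M)}
  refine Module.FinitePresentation.of_localizationSpan s ?_ ?_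
  · by_contra hs
    obtain ⟨m, hm, hle⟩ := Ideal.exists_le_maximal _ hs
    obtain ⟨a, ha, hfree⟩ := Module.Free.away_of_finite_of_flat_of_rankAtStalk_constant M m
      (fun m' _ => by rw [h, h])
    exact ha (hle (Ideal.subset_span hfree))
  · rintro ⟨a, ha⟩
    have : Module.Free (Localization.Away a) (LocalizedModule.Away a M) := ha
    exact Module.finitePresentation_of_projective _ _

theorem finitePresentation_of_isLocallyConstant_rankAtStalk
    (R M : Type*) [CommRing R] [AddCommGroup M] [Module R M]
    [Module.Finite R M] [Module.Flat R M]
    (h : IsLocallyConstant (Module.rankAtStalk (R := R) M)) :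
    Module.FinitePresentation R M := by
  let s : Set R := {a | Module.FinitePresentation (Localization.Away a) (LocalizedModule.Away a M)}
  refine Module.FinitePresentation.of_localizationSpan s ?_ (fun g => g.2)
  by_contra hs
  obtain ⟨m, hm, hle⟩ := Ideal.exists_le_maximal _ hs
  obtain ⟨U, hU, hmU, hc⟩ := (IsLocallyConstant.iff_exists_open _).mp h ⟨m, hm.isPrime⟩
  obtain ⟨_, ⟨a, rfl⟩, ha, haU⟩ :=
    PrimeSpectrum.isTopologicalBasis_basic_opens.exists_subset_of_mem_open hmU hU
  refine ha (hle (Ideal.subset_span ?_))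
  refine finitePresentation_of_rankAtStalk_const _ _
    (Module.rankAtStalk M ⟨m, hm.isPrime⟩) fun p => ?_
  rw [Module.rankAtStalk_isBaseChange
    (LocalizedModule.isBaseChange (Submonoid.powers a) M)]
  refine hc _ (haU ?_)
  have : PrimeSpectrum.comap (algebraMap R (Localization.Away a)) p ∈
      Set.range (PrimeSpectrum.comap (algebraMap R (Localization.Away a))) := ⟨p, rfl⟩
  rwa [PrimeSpectrum.localization_away_comap_range (Localization.Away a) a] at this

/-- A finitely generated flat module is projective iff its rank function on
`Spec R` is locally constant. -/
theorem projective_iff_rank_isLocallyConstant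
    (R M : Type*) [CommRing R] [AddCommGroup M] [Module R M]
    [Module.Finite R M] [Module.Flat R M] :
    Module.Projective R M ↔
      IsLocallyConstant (fun p : PrimeSpectrum R =>
        Module.finrank (Localization.AtPrime p.asIdeal)
          (LocalizedModule p.asIdeal.primeCompl M)) := by
  constructor
  · intro _
    have := Module.finitePresentation_of_projective R M
    exact Module.isLocallyConstant_rankAtStalk
  · intro h
    have := finitePresentation_of_isLocallyConstant_rankAtStalk R M h
    refine Module.projective_of_localization_maximal fun I hI => ?_
    have := Module.free_of_flat_of_isLocalRing (R := Localization.AtPrime I)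
      (P := LocalizedModule I.primeCompl M)
    infer_instance
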